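/- arXiv:2503.00873 — 2 statements merged into one kernel-verified Lean document; each statement's English description precedes it below -/
import Mathlib

section
/- Let n ≥ 2, let 𝔻 be the parabolic dyadic grid on ℝ^{n-1} × ℝ, and let 𝐒 ⊆ 𝔻 be a semi-coherent stopping time regime with maximal cube Q(𝐒). Define d(𝐱) := inf_{Q ∈ 𝐒} (dist(𝐱, Q) + diam(Q)) (parabolic distance and parabolic diameter). Suppose Q₀ ∈ 𝐒, 𝐱 ∈ 500Q₀, and ρ ∈ ℝ satisfies d(𝐱)/100 < ρ < 10¹⁰ diam(Q₀). Then there exists a cube Q ∈ 𝐒 such that dist(𝐱, Q) ≤ 10³ √n · diam(Q) and 10⁻¹⁰ diam(Q) ≤ ρ ≤ 10¹⁰ diam(Q). -/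
/-- Parabolic distance on space-time `ℝ^{m} × ℝ`. -/
noncomputable def pd {m : ℕ} (X Y : EuclideanSpace ℝ (Fin m) × ℝ) : ℝ :=
  ‖X.1 - Y.1‖ + Real.sqrt |X.2 - Y.2|

/-- A parabolic dyadic cube of the grid `𝔻`, recorded by its parameters `(k, v, j)`. -/
structure PCube (m : ℕ) where
  k : ℤ
  v : Fin m → ℤ
  j : ℤ

/-- The underlying set of a parabolic dyadic cube. -/
def PCube.carrier {m : ℕ} (Q : PCube m) : Set (EuclideanSpace ℝ (Fin m) × ℝ) :=
  {p | (∀ i, p.1 i ∈ Set.Ico ((2 : ℝ) ^ (-Q.k) * Q.v i) ((2 : ℝ) ^ (-Q.k) * (Q.v i + 1))) ∧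
    p.2 ∈ Set.Ico ((4 : ℝ) ^ (-Q.k) * Q.j) ((4 : ℝ) ^ (-Q.k) * (Q.j + 1))}

/-- The concentric dilate `λ Q` of a parabolic dyadic cube. -/
noncomputable def PCube.dilate {m : ℕ} (Q : PCube m) (lam : ℝ) :
    Set (EuclideanSpace ℝ (Fin m) × ℝ) :=
  {p | (∀ i, |p.1 i - (2 : ℝ) ^ (-Q.k) * (Q.v i + 1 / 2)| < lam * (2 : ℝ) ^ (-Q.k) / 2) ∧
    |p.2 - (4 : ℝ) ^ (-Q.k) * (Q.j + 1 / 2)| < lam * (4 : ℝ) ^ (-Q.k) / 2}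

/-- `𝐒` is a semi-coherent stopping time regime with maximal cube `Qmax`. -/
def SemiCoherent {m : ℕ} (S : Set (PCube m)) (Qmax : PCube m) : Prop :=
  Qmax ∈ S ∧ (∀ Q ∈ S, Q.carrier ⊆ Qmax.carrier) ∧
    ∀ Q' ∈ S, ∀ Qstar ∈ S, ∀ Q : PCube m,
      Q'.carrier ⊆ Q.carrier → Q.carrier ⊆ Qstar.carrier → Q ∈ S

/-- Parabolic distance from a point to a set. -/
noncomputable def pdistSet {m : ℕ} (x : EuclideanSpace ℝ (Fin m) × ℝ)
    (Q : Set (EuclideanSpace ℝ (Fin m) × ℝ)) : ℝ :=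
  sInf {r : ℝ | ∃ q ∈ Q, r = pd x q}

/-- Parabolic diameter of a set. -/
noncomputable def pdiam {m : ℕ} (Q : Set (EuclideanSpace ℝ (Fin m) × ℝ)) : ℝ :=
  sSup {r : ℝ | ∃ a ∈ Q, ∃ b ∈ Q, r = pd a b}

/-- The parabolic diameter of a cube is comparable to this quantity. -/
noncomputable def PCube.size {m : ℕ} (Q : PCube m) : ℝ := (Real.sqrt m + 1) * (2 : ℝ) ^ (-Q.k)

/-- The centre of a parabolic dyadic cube. -/
noncomputable def PCube.center {m : ℕ} (Q : PCube m) : EuclideanSpace ℝ (Fin m) × ℝ :=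
  (WithLp.toLp 2 fun i => (2 : ℝ) ^ (-Q.k) * (Q.v i + 1 / 2), (4 : ℝ) ^ (-Q.k) * (Q.j + 1 / 2))

/-- The corner of a parabolic dyadic cube at which all coordinates are minimal. -/
noncomputable def PCube.corner {m : ℕ} (Q : PCube m) : EuclideanSpace ℝ (Fin m) × ℝ :=
  (WithLp.toLp 2 fun i => (2 : ℝ) ^ (-Q.k) * Q.v i, (4 : ℝ) ^ (-Q.k) * Q.j)

/-- The dyadic parent of a parabolic dyadic cube. -/
def PCube.parent {m : ℕ} (Q : PCube m) : PCube m := ⟨Q.k - 1, fun i => Q.v i / 2, Q.j / 4⟩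

lemma PCube.size_parent {m : ℕ} (Q : PCube m) : Q.parent.size = 2 * Q.size := by
  have : (2 : ℝ) ^ (-(Q.k - 1)) = 2 * 2 ^ (-Q.k) := by
    rw [show -(Q.k - 1) = 1 + -Q.k by ring, zpow_add₀ (by norm_num), zpow_one]
  simp only [PCube.size, PCube.parent, this]
  ring

lemma four_zpow_eq_sq (k : ℤ) : (4 : ℝ) ^ k = ((2 : ℝ) ^ k) ^ 2 := by
  rw [show (4 : ℝ) = 2 * 2 by norm_num, mul_zpow, sq]

lemma PCube.center_mem {m : ℕ} (Q : PCube m) : Q.center ∈ Q.carrier := by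
  have h2 : (0 : ℝ) < 2 ^ (-Q.k) := by positivity
  have h4 : (0 : ℝ) < 4 ^ (-Q.k) := by positivity
  refine ⟨fun i => ⟨?_, ?_⟩, ?_, ?_⟩ <;> simp only [PCube.center] <;> nlinarith

lemma PCube.corner_mem {m : ℕ} (Q : PCube m) : Q.corner ∈ Q.carrier := by
  have h2 : (0 : ℝ) < 2 ^ (-Q.k) := by positivity
  have h4 : (0 : ℝ) < 4 ^ (-Q.k) := by positivity
  refine ⟨fun i => ⟨?_, ?_⟩, ?_, ?_⟩ <;> simp only [PCube.corner] <;> nlinarith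

lemma pd_nonneg {m : ℕ} (X Y : EuclideanSpace ℝ (Fin m) × ℝ) : 0 ≤ pd X Y := by
  unfold pd; positivity

lemma norm_le_sqrt_mul {m : ℕ} (v : EuclideanSpace ℝ (Fin m)) {c : ℝ} (hc : 0 ≤ c)
    (h : ∀ i, |v i| ≤ c) : ‖v‖ ≤ Real.sqrt m * c := by
  rw [EuclideanSpace.norm_eq]
  refine Real.sqrt_le_iff.2 ⟨by positivity, ?_⟩
  rw [mul_pow, Real.sq_sqrt (by positivity)]
  calc ∑ i, ‖v i‖ ^ 2 ≤ ∑ _i : Fin m, c ^ 2 :=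
        Finset.sum_le_sum fun i _ => pow_le_pow_left₀ (norm_nonneg _) (h i) 2
    _ = m * c ^ 2 := by simp

lemma sqrt_mul_le_norm {m : ℕ} (v : EuclideanSpace ℝ (Fin m)) {c : ℝ} (hc : 0 ≤ c)
    (h : ∀ i, c ≤ |v i|) : Real.sqrt m * c ≤ ‖v‖ := by
  rw [EuclideanSpace.norm_eq]
  refine Real.le_sqrt_of_sq_le ?_
  rw [mul_pow, Real.sq_sqrt (by positivity)]
  calc m * c ^ 2 = ∑ _i : Fin m, c ^ 2 := by simp
    _ ≤ ∑ i, ‖v i‖ ^ 2 := Finset.sum_le_sum fun i _ => pow_le_pow_left₀ hc (h i) 2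

lemma PCube.pd_le_size {m : ℕ} (Q : PCube m) {a b : EuclideanSpace ℝ (Fin m) × ℝ}
    (ha : a ∈ Q.carrier) (hb : b ∈ Q.carrier) : pd a b ≤ Q.size := by
  have hs : (0 : ℝ) ≤ 2 ^ (-Q.k) := by positivity
  have h1 : ‖a.1 - b.1‖ ≤ Real.sqrt m * 2 ^ (-Q.k) := by
    refine norm_le_sqrt_mul _ hs fun i => ?_
    obtain ⟨ha1, ha2⟩ := ha.1 i
    obtain ⟨hb1, hb2⟩ := hb.1 i
    rw [PiLp.sub_apply, abs_le]
    constructor <;> linarith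
  have h2 : Real.sqrt |a.2 - b.2| ≤ 2 ^ (-Q.k) := by
    refine Real.sqrt_le_iff.2 ⟨hs, ?_⟩
    obtain ⟨ha1, ha2⟩ := ha.2
    obtain ⟨hb1, hb2⟩ := hb.2
    rw [← four_zpow_eq_sq, abs_le]
    constructor <;> linarith
  unfold pd PCube.size
  linarith

lemma PCube.bddAbove_pd {m : ℕ} (Q : PCube m) :
    BddAbove {r : ℝ | ∃ a ∈ Q.carrier, ∃ b ∈ Q.carrier, r = pd a b} := by
  refine ⟨Q.size, ?_⟩
  rintro r ⟨a, ha, b, hb, rfl⟩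
  exact Q.pd_le_size ha hb

lemma PCube.pdiam_le_size {m : ℕ} (Q : PCube m) : pdiam Q.carrier ≤ Q.size := by
  refine csSup_le ⟨_, _, Q.center_mem, _, Q.center_mem, rfl⟩ ?_
  rintro r ⟨a, ha, b, hb, rfl⟩
  exact Q.pd_le_size ha hb

lemma PCube.size_le_two_mul_pdiam {m : ℕ} (Q : PCube m) : Q.size ≤ 2 * pdiam Q.carrier := by
  have hs : (0 : ℝ) < 2 ^ (-Q.k) := by positivity
  have h : pd Q.center Q.corner ≤ pdiam Q.carrier :=
    le_csSup Q.bddAbove_pd ⟨_, Q.center_mem, _, Q.corner_mem, rfl⟩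
  have h1 : Real.sqrt m * (2 ^ (-Q.k) / 2) ≤ ‖Q.center.1 - Q.corner.1‖ := by
    refine sqrt_mul_le_norm _ (by positivity) fun i => le_trans (le_of_eq ?_) (le_abs_self _)
    simp only [PCube.center, PCube.corner, PiLp.sub_apply]
    ring
  have h2 : 2 ^ (-Q.k) / 2 ≤ Real.sqrt |Q.center.2 - Q.corner.2| := by
    refine Real.le_sqrt_of_sq_le (le_trans ?_ (le_abs_self _))
    simp only [PCube.center, PCube.corner, four_zpow_eq_sq]
    nlinarith
  unfold pd at h
  unfold PCube.size
  linarith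

lemma pdiam_mono {m : ℕ} {Q R : PCube m} (h : Q.carrier ⊆ R.carrier) :
    pdiam Q.carrier ≤ pdiam R.carrier := by
  refine csSup_le_csSup R.bddAbove_pd ⟨_, _, Q.center_mem, _, Q.center_mem, rfl⟩ ?_
  rintro r ⟨a, ha, b, hb, rfl⟩
  exact ⟨a, h ha, b, h hb, rfl⟩

lemma pdistSet_le_pd {m : ℕ} (x : EuclideanSpace ℝ (Fin m) × ℝ)
    {A : Set (EuclideanSpace ℝ (Fin m) × ℝ)} {q : EuclideanSpace ℝ (Fin m) × ℝ} (hq : q ∈ A) :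
    pdistSet x A ≤ pd x q := by
  refine csInf_le ⟨0, ?_⟩ ⟨q, hq, rfl⟩
  rintro r ⟨a, -, rfl⟩
  exact pd_nonneg _ _

lemma pdistSet_nonneg {m : ℕ} (x : EuclideanSpace ℝ (Fin m) × ℝ)
    (A : Set (EuclideanSpace ℝ (Fin m) × ℝ)) : 0 ≤ pdistSet x A := by
  refine Real.sInf_nonneg ?_
  rintro r ⟨a, -, rfl⟩
  exact pd_nonneg _ _

lemma pdistSet_anti {m : ℕ} (x : EuclideanSpace ℝ (Fin m) × ℝ)
    {A B : Set (EuclideanSpace ℝ (Fin m) × ℝ)} (hA : A.Nonempty) (h : A ⊆ B) :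
    pdistSet x B ≤ pdistSet x A := by
  obtain ⟨q, hq⟩ := hA
  refine le_csInf ⟨_, q, hq, rfl⟩ ?_
  rintro r ⟨a, ha, rfl⟩
  exact pdistSet_le_pd x (h ha)

lemma PCube.pdistSet_le_of_mem_dilate {m : ℕ} (Q : PCube m)
    {x : EuclideanSpace ℝ (Fin m) × ℝ} {lam : ℝ} (hlam : 2 ≤ lam) (hx : x ∈ Q.dilate lam) :
    pdistSet x Q.carrier ≤ lam / 2 * Q.size := by
  have hs : (0 : ℝ) < 2 ^ (-Q.k) := by positivity
  refine (pdistSet_le_pd x Q.center_mem).trans ?_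
  have h1 : ‖x.1 - Q.center.1‖ ≤ Real.sqrt m * (lam * 2 ^ (-Q.k) / 2) := by
    refine norm_le_sqrt_mul _ (by positivity) fun i => ?_
    exact (hx.1 i).le
  have h2 : Real.sqrt |x.2 - Q.center.2| ≤ lam * 2 ^ (-Q.k) / 2 := by
    refine Real.sqrt_le_iff.2 ⟨by positivity, hx.2.le.trans ?_⟩
    rw [four_zpow_eq_sq]
    have : 0 ≤ (2 : ℝ) ^ (-Q.k) * 2 ^ (-Q.k) * (lam * (lam - 2)) :=
      mul_nonneg (by positivity) (mul_nonneg (by linarith) (by linarith))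
    nlinarith
  unfold pd PCube.size
  linarith

lemma Ico_subset_Ico_parent {b : ℤ} (hb : 0 < b) (k v : ℤ) :
    Set.Ico ((b : ℝ) ^ (-k) * v) ((b : ℝ) ^ (-k) * (v + 1)) ⊆
      Set.Ico ((b : ℝ) ^ (-(k - 1)) * (v / b : ℤ)) ((b : ℝ) ^ (-(k - 1)) * ((v / b : ℤ) + 1)) := by
  have hb' : (0 : ℝ) < b := by exact_mod_cast hb
  have hs : (0 : ℝ) < (b : ℝ) ^ (-k) := by positivity
  have e : (b : ℝ) ^ (-(k - 1)) = b ^ (-k) * b := by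
    rw [show -(k - 1) = -k + 1 by ring, zpow_add₀ hb'.ne', zpow_one]
  have h1 : (b : ℝ) * (v / b : ℤ) ≤ v := by exact_mod_cast Int.mul_ediv_self_le hb.ne'
  have h2 : (v : ℝ) + 1 ≤ b * ((v / b : ℤ) + 1) := by
    have := Int.lt_mul_ediv_self_add (x := v) hb
    have : v + 1 ≤ b * (v / b + 1) := by linarith
    exact_mod_cast this
  rw [e, mul_assoc, mul_assoc]
  exact Set.Ico_subset_Ico (by gcongr) (by gcongr)

lemma Ico_parent_subset_Ico {b : ℤ} (hb : 0 < b) {k v K V : ℤ} (hk : K < k)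
    (h : (b : ℝ) ^ (-k) * v ∈ Set.Ico ((b : ℝ) ^ (-K) * V) ((b : ℝ) ^ (-K) * (V + 1))) :
    Set.Ico ((b : ℝ) ^ (-(k - 1)) * (v / b : ℤ)) ((b : ℝ) ^ (-(k - 1)) * ((v / b : ℤ) + 1)) ⊆
      Set.Ico ((b : ℝ) ^ (-K) * V) ((b : ℝ) ^ (-K) * (V + 1)) := by
  obtain ⟨N, rfl⟩ : ∃ N : ℕ, k = K + 1 + N := ⟨(k - K - 1).toNat, by omega⟩
  have hb' : (0 : ℝ) < b := by exact_mod_cast hb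
  have hs : (0 : ℝ) < (b : ℝ) ^ (-(K + 1 + (N : ℤ))) := by positivity
  set s := (b : ℝ) ^ (-(K + 1 + (N : ℤ))) with hs_def
  have e1 : (b : ℝ) ^ (-(K + 1 + (N : ℤ) - 1)) = s * b := by
    rw [show -(K + 1 + (N : ℤ) - 1) = -(K + 1 + (N : ℤ)) + 1 by ring, zpow_add₀ hb'.ne', zpow_one]
  have e2 : (b : ℝ) ^ (-K) = s * b * b ^ N := by
    rw [show -K = -(K + 1 + (N : ℤ)) + 1 + N by ring, zpow_add₀ hb'.ne', zpow_add₀ hb'.ne',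
      zpow_one, zpow_natCast]
  rw [e2] at h
  obtain ⟨h1, h2⟩ := h
  have h1' : b * (b ^ N * V) ≤ v := by
    have : (b : ℝ) * (b ^ N * V) ≤ v := by
      refine le_of_mul_le_mul_left ?_ hs
      linarith
    exact_mod_cast this
  have h2' : v < b * (b ^ N * (V + 1)) := by
    have : (v : ℝ) < b * (b ^ N * (V + 1)) := by
      refine lt_of_mul_lt_mul_left ?_ hs.le
      linarith
    exact_mod_cast this
  have h3 : b ^ N * V ≤ v / b := (Int.le_ediv_iff_mul_le hb).2 (by linarith)
  have h4 : v / b + 1 ≤ b ^ N * (V + 1) := Int.ediv_lt_of_lt_mul hb (by linarith)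
  have h3' : (b : ℝ) ^ N * V ≤ (v / b : ℤ) := by exact_mod_cast h3
  have h4' : ((v / b : ℤ) : ℝ) + 1 ≤ b ^ N * (V + 1) := by exact_mod_cast h4
  rw [e1, e2, mul_assoc _ _ (V : ℝ), mul_assoc _ _ ((V : ℝ) + 1)]
  exact Set.Ico_subset_Ico (by gcongr) (by gcongr)

lemma PCube.carrier_subset_parent {m : ℕ} (Q : PCube m) : Q.carrier ⊆ Q.parent.carrier := by
  intro p hp
  refine ⟨fun i => ?_, ?_⟩
  · have := Ico_subset_Ico_parent (b := 2) (by norm_num) Q.k (Q.v i)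
    simp only [Int.cast_ofNat] at this
    exact this (hp.1 i)
  · have := Ico_subset_Ico_parent (b := 4) (by norm_num) Q.k Q.j
    simp only [Int.cast_ofNat] at this
    exact this hp.2

lemma PCube.parent_carrier_subset {m : ℕ} {Q R : PCube m} (h : Q.carrier ⊆ R.carrier)
    (hk : R.k < Q.k) : Q.parent.carrier ⊆ R.carrier := by
  intro p hp
  have hc := h Q.corner_mem
  refine ⟨fun i => ?_, ?_⟩
  · have := Ico_parent_subset_Ico (b := 2) (v := Q.v i) (V := R.v i) (by norm_num) hk
    simp only [Int.cast_ofNat] at this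
    exact this (hc.1 i) (hp.1 i)
  · have := Ico_parent_subset_Ico (b := 4) (v := Q.j) (V := R.j) (by norm_num) hk
    simp only [Int.cast_ofNat] at this
    exact this hc.2 hp.2

lemma SemiCoherent.parent_mem {m : ℕ} {S : Set (PCube m)} {Qmax Q : PCube m}
    (hS : SemiCoherent S Qmax) (hQ : Q ∈ S) (hk : Qmax.k < Q.k) : Q.parent ∈ S :=
  hS.2.2 Q hQ Qmax hS.1 _ Q.carrier_subset_parent (PCube.parent_carrier_subset (hS.2.1 Q hQ) hk)

lemma SemiCoherent.exists_ancestor {m : ℕ} {S : Set (PCube m)} {Qmax : PCube m}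
    (hS : SemiCoherent S Qmax) {A : ℝ} (hmax : A ≤ Qmax.size) {Q : PCube m} (hQ : Q ∈ S)
    (hA : Q.size < A) :
    ∃ R ∈ S, Q.carrier ⊆ R.carrier ∧ A ≤ R.size ∧ R.size ≤ 2 * A := by
  have hk : Qmax.k < Q.k := by
    have h : Q.size < Qmax.size := hA.trans_le hmax
    unfold PCube.size at h
    have := (zpow_lt_zpow_iff_right₀ (by norm_num : (1 : ℝ) < 2)).1
      (lt_of_mul_lt_mul_left h (by positivity))
    omega
  obtain ⟨N, hN⟩ : ∃ N : ℕ, Q.k = Qmax.k + N := ⟨(Q.k - Qmax.k).toNat, by omega⟩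
  clear hk
  induction N generalizing Q with
  | zero =>
    have : Q.size = Qmax.size := by simp [PCube.size, hN]
    linarith
  | succ N ih =>
    have hP := hS.parent_mem hQ (by push_cast at hN; omega)
    have hsize := Q.size_parent
    rcases lt_or_ge Q.parent.size A with h | h
    · obtain ⟨R, hR, hsub, h1, h2⟩ := ih hP h (by simp only [PCube.parent, hN]; push_cast; ring)
      exact ⟨R, hR, Q.carrier_subset_parent.trans hsub, h1, h2⟩
    · exact ⟨_, hP, Q.carrier_subset_parent, h, by linarith⟩


/-- in a semi-coherent stopping time regime `𝐒`, given `Q₀ ∈ 𝐒`,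
`𝐱 ∈ 500Q₀` and a scale `ρ` with `d(𝐱)/100 < ρ < 10¹⁰ diam(Q₀)` (where `d` is the
stopping-time distance), there is a cube `Q ∈ 𝐒` with `dist(𝐱,Q) ≤ 10³√n diam(Q)`
and `10⁻¹⁰ diam(Q) ≤ ρ ≤ 10¹⁰ diam(Q)`. -/
theorem statement7
    (n : ℕ) (hn : 2 ≤ n)
    (S : Set (PCube (n - 1))) (Qmax : PCube (n - 1)) (hS : SemiCoherent S Qmax)
    (Q₀ : PCube (n - 1)) (hQ₀ : Q₀ ∈ S)
    (x : EuclideanSpace ℝ (Fin (n - 1)) × ℝ) (hx : x ∈ Q₀.dilate 500)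
    (ρ : ℝ)
    (hρ₁ : sInf {r : ℝ | ∃ Q ∈ S, r = pdistSet x Q.carrier + pdiam Q.carrier} / 100 < ρ)
    (hρ₂ : ρ < 10 ^ 10 * pdiam Q₀.carrier) :
    ∃ Q ∈ S, pdistSet x Q.carrier ≤ 10 ^ 3 * Real.sqrt n * pdiam Q.carrier ∧
      ((10 : ℝ) ^ 10)⁻¹ * pdiam Q.carrier ≤ ρ ∧ ρ ≤ 10 ^ 10 * pdiam Q.carrier := by
  have hD₀ : 0 < Q₀.size := by unfold PCube.size; positivity
  have h₀ := Q₀.size_le_two_mul_pdiam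
  have hn₁ : (1 : ℝ) ≤ Real.sqrt n := Real.one_le_sqrt.2 (by exact_mod_cast (by omega : 1 ≤ n))
  rcases le_or_gt (((10 : ℝ) ^ 10)⁻¹ * pdiam Q₀.carrier) ρ with hcase | hcase
  · refine ⟨Q₀, hQ₀, ?_, hcase, hρ₂.le⟩
    have := Q₀.pdistSet_le_of_mem_dilate (by norm_num) hx
    nlinarith
  obtain ⟨r, ⟨Q₁, hQ₁, rfl⟩, hr⟩ := exists_lt_of_csInf_lt
    (s := {r : ℝ | ∃ Q ∈ S, r = pdistSet x Q.carrier + pdiam Q.carrier}) (b := 100 * ρ)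
    ⟨_, Q₀, hQ₀, rfl⟩ (by linarith)
  have hdist := pdistSet_nonneg x Q₁.carrier
  have hsize₁ := Q₁.size_le_two_mul_pdiam
  have hD₁ : 0 < Q₁.size := by unfold PCube.size; positivity
  have hmax : 200 * ρ ≤ Qmax.size := by
    have h1 := pdiam_mono (hS.2.1 Q₀ hQ₀)
    have h2 := Qmax.pdiam_le_size
    norm_num at hcase
    linarith
  obtain ⟨R, hR, hsub, h1, h2⟩ := hS.exists_ancestor hmax hQ₁ (by linarith)
  have hR₁ := R.pdiam_le_size
  have hR₂ := R.size_le_two_mul_pdiam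
  refine ⟨R, hR, ?_, by norm_num; linarith, by norm_num; linarith⟩
  have := pdistSet_anti x ⟨_, Q₁.center_mem⟩ hsub
  nlinarith
end

section
/- (Big pieces implies corona.) Let n ≥ 2 and let 𝔻 be the parabolic dyadic grid on ℝ^{n-1} × ℝ. Let R be a binary relation on 𝔻 and assume: for every Q₀ ∈ 𝔻 there exists a countable collection F(Q₀) ⊆ 𝔻 of pairwise disjoint cubes, each contained in Q₀, with |⋃_{Q' ∈ F(Q₀)} Q'| ≤ |Q₀|/4, such that R(Q₀, Q) holds for every Q ∈ 𝔻 with Q ⊆ Q₀ that is not contained in any member of F(Q₀). Then for every Q* ∈ 𝔻, the collection 𝔻(Q*) := {Q ∈ 𝔻 : Q ⊆ Q*} can be partitioned into countably many pairwise disjoint semi-coherent stopping time regimes {𝐒_i}_i such that R(Q(𝐒_i), Q) holds for every i and every Q ∈ 𝐒_i, and the maximal cubes pack: for every P ∈ 𝔻, Σ_{i : Q(𝐒_i) ⊆ P} |Q(𝐒_i)| ≤ (4/3) |P|. -/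
open MeasureTheory

open Set Function
open scoped ENNReal

section Corona

variable {X α : Type*} {c : α → Set X} {F : α → Set α} {q : α}

/-- The generations of stopping elements obtained from `q` by iterating `F`. -/
def stoppingGeneration (F : α → Set α) (q : α) : ℕ → Set α
  | 0 => {q}
  | k + 1 => ⋃ T ∈ stoppingGeneration F q k, F T

/-- The elements below `T` that are not below any element of `F T`. -/
def stoppingRegion (c : α → Set X) (F : α → Set α) (T : α) : Set α :=
  {Q | c Q ⊆ c T ∧ ∀ U ∈ F T, ¬ c Q ⊆ c U}

lemma mem_stoppingGeneration_succ {k : ℕ} {U : α} :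
    U ∈ stoppingGeneration F q (k + 1) ↔ ∃ T ∈ stoppingGeneration F q k, U ∈ F T := by
  simp [stoppingGeneration]

lemma exists_ancestor (hsub : ∀ T, ∀ U ∈ F T, c U ⊆ c T) {k l : ℕ} (hkl : k ≤ l) :
    ∀ T ∈ stoppingGeneration F q l, ∃ V ∈ stoppingGeneration F q k, c T ⊆ c V := by
  induction l, hkl using Nat.le_induction with
  | base => exact fun T hT => ⟨T, hT, Subset.rfl⟩
  | succ l _ ih =>
    intro U hU
    obtain ⟨T, hT, hUT⟩ := mem_stoppingGeneration_succ.1 hU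
    obtain ⟨V, hV, hTV⟩ := ih T hT
    exact ⟨V, hV, (hsub T U hUT).trans hTV⟩

lemma pairwiseDisjoint_stoppingGeneration (hsub : ∀ T, ∀ U ∈ F T, c U ⊆ c T)
    (hdisj : ∀ T, (F T).PairwiseDisjoint c) (k : ℕ) :
    (stoppingGeneration F q k).PairwiseDisjoint c := by
  induction k with
  | zero => exact pairwiseDisjoint_singleton q c
  | succ k ih =>
    intro U hU U' hU' hne
    obtain ⟨T, hT, hUT⟩ := mem_stoppingGeneration_succ.1 hU
    obtain ⟨T', hT', hUT'⟩ := mem_stoppingGeneration_succ.1 hU'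
    by_cases h : T = T'
    · subst h
      exact hdisj T hUT hUT' hne
    · exact (ih hT hT' h).mono (hsub T U hUT) (hsub T' U' hUT')

lemma eq_of_inter_nonempty {s : Set α} (hs : s.PairwiseDisjoint c) {T T' : α}
    (hT : T ∈ s) (hT' : T' ∈ s) (h : (c T ∩ c T').Nonempty) : T = T' :=
  hs.elim hT hT' (not_disjoint_iff_nonempty_inter.2 h)

lemma exists_subset_stopping_of_lt (hsub : ∀ T, ∀ U ∈ F T, c U ⊆ c T)
    (hdisj : ∀ T, (F T).PairwiseDisjoint c) {k l : ℕ} (hkl : k < l) {T T' : α}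
    (hT : T ∈ stoppingGeneration F q k) (hT' : T' ∈ stoppingGeneration F q l)
    (h : (c T ∩ c T').Nonempty) : ∃ U ∈ F T, c T' ⊆ c U := by
  obtain ⟨U, hU, hTU⟩ := exists_ancestor hsub hkl T' hT'
  obtain ⟨V, hV, hUV⟩ := mem_stoppingGeneration_succ.1 hU
  obtain rfl : T = V := eq_of_inter_nonempty (pairwiseDisjoint_stoppingGeneration hsub hdisj k)
    hT hV (h.mono (inter_subset_inter_right _ (hTU.trans (hsub V U hUV))))
  exact ⟨U, hUV, hTU⟩

lemma pairwiseDisjoint_stoppingRegion (hne : ∀ T, (c T).Nonempty)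
    (hsub : ∀ T, ∀ U ∈ F T, c U ⊆ c T) (hdisj : ∀ T, (F T).PairwiseDisjoint c) :
    (⋃ k, stoppingGeneration F q k).PairwiseDisjoint (stoppingRegion c F) := by
  intro T hT T' hT' hTT'
  obtain ⟨k, hk⟩ := mem_iUnion.1 hT
  obtain ⟨l, hl⟩ := mem_iUnion.1 hT'
  refine Set.disjoint_left.2 fun Q hQ hQ' => ?_
  have hinter : (c T ∩ c T').Nonempty := (hne Q).mono (subset_inter hQ.1 hQ'.1)
  rcases lt_trichotomy k l with h | rfl | h
  · obtain ⟨U, hU, hTU⟩ := exists_subset_stopping_of_lt hsub hdisj h hk hl hinter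
    exact hQ.2 U hU (hQ'.1.trans hTU)
  · exact hTT' (eq_of_inter_nonempty (pairwiseDisjoint_stoppingGeneration hsub hdisj k)
      hk hl hinter)
  · obtain ⟨U, hU, hTU⟩ :=
      exists_subset_stopping_of_lt hsub hdisj h hl hk (by rwa [inter_comm])
    exact hQ'.2 U hU (hQ.1.trans hTU)

variable [MeasurableSpace X] {μ : Measure X}

lemma mem_stoppingRegion_self (h0 : ∀ T, μ (c T) ≠ 0) (htop : ∀ T, μ (c T) ≠ ∞)
    (hvol : ∀ T, μ (⋃ U ∈ F T, c U) ≤ μ (c T) / 4) (T : α) : T ∈ stoppingRegion c F T := by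
  refine ⟨Subset.rfl, fun U hU h => ?_⟩
  have hle : μ (c T) ≤ μ (c T) / 4 :=
    (measure_mono (h.trans (subset_biUnion_of_mem (u := c) hU))).trans (hvol T)
  exact (ENNReal.div_lt_of_lt_mul' (by
    simpa using ENNReal.mul_lt_mul_left (h0 T) (htop T) (by norm_num : (1 : ℝ≥0∞) < 4))).not_ge hle

lemma tsum_measure_eq [Countable α] (hm : ∀ T, MeasurableSet (c T)) {s : Set α}
    (hs : s.PairwiseDisjoint c) : ∑' T : s, μ (c T) = μ (⋃ T ∈ s, c T) :=
  (measure_biUnion s.to_countable hs fun T _ => hm T).symm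

lemma measure_stopping_le [Countable α] (hm : ∀ T, MeasurableSet (c T))
    (hvol : ∀ T, μ (⋃ U ∈ F T, c U) ≤ μ (c T) / 4) {s t : Set α} (hs : s.PairwiseDisjoint c)
    (ht : t ⊆ ⋃ T ∈ s, F T) : μ (⋃ U ∈ t, c U) ≤ μ (⋃ T ∈ s, c T) / 4 :=
  calc μ (⋃ U ∈ t, c U) ≤ μ (⋃ T ∈ s, ⋃ U ∈ F T, c U) := by
        refine measure_mono (iUnion₂_subset fun U hU => ?_)
        obtain ⟨T, hT, hUT⟩ := mem_iUnion₂.1 (ht hU)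
        exact (subset_biUnion_of_mem (u := c) hUT).trans
          (subset_biUnion_of_mem (u := fun T => ⋃ U ∈ F T, c U) hT)
    _ ≤ ∑' T : s, μ (⋃ U ∈ F T, c U) := measure_biUnion_le μ s.to_countable _
    _ ≤ ∑' T : s, μ (c T) / 4 := ENNReal.tsum_le_tsum fun T => hvol T
    _ = μ (⋃ T ∈ s, c T) / 4 := by
        simp only [div_eq_mul_inv, ENNReal.tsum_mul_right, tsum_measure_eq hm hs]

lemma le_geometric_of_succ_le {a : ℕ → ℝ≥0∞} (h : ∀ k, a (k + 1) ≤ a k / 4) (k : ℕ) :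
    a k ≤ a 0 * (4⁻¹) ^ k := by
  induction k with
  | zero => simp
  | succ k ih =>
    calc a (k + 1) ≤ a k / 4 := h k
      _ ≤ a 0 * (4⁻¹) ^ k / 4 := by gcongr
      _ = a 0 * (4⁻¹) ^ (k + 1) := by rw [pow_succ, div_eq_mul_inv, mul_assoc]

lemma tsum_le_of_succ_le {a : ℕ → ℝ≥0∞} (h : ∀ k, a (k + 1) ≤ a k / 4) :
    ∑' k, a k ≤ 4 / 3 * a 0 :=
  calc ∑' k, a k ≤ ∑' k, a 0 * (4⁻¹) ^ k := ENNReal.tsum_le_tsum (le_geometric_of_succ_le h)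
    _ = a 0 * (1 - 4⁻¹)⁻¹ := by rw [ENNReal.tsum_mul_left, ENNReal.tsum_geometric]
    _ = 4 / 3 * a 0 := by
        have h₁ : (1 - 4⁻¹ : ℝ≥0∞) = 3 / 4 := by
          refine ENNReal.sub_eq_of_eq_add (by simp) ?_
          rw [← one_div, ← ENNReal.add_div]
          norm_num [ENNReal.div_self]
        rw [h₁, ENNReal.inv_div (by simp) (by simp), mul_comm]

lemma biUnion_stoppingRegion [Countable α] (hm : ∀ T, MeasurableSet (c T))
    (h0 : ∀ T, μ (c T) ≠ 0) (htop : ∀ T, μ (c T) ≠ ∞)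
    (hsub : ∀ T, ∀ U ∈ F T, c U ⊆ c T) (hdisj : ∀ T, (F T).PairwiseDisjoint c)
    (hvol : ∀ T, μ (⋃ U ∈ F T, c U) ≤ μ (c T) / 4) :
    ⋃ T ∈ ⋃ k, stoppingGeneration F q k, stoppingRegion c F T = {Q | c Q ⊆ c q} := by
  refine Subset.antisymm (iUnion₂_subset fun T hT Q hQ => ?_) fun Q hQ => ?_
  · obtain ⟨k, hk⟩ := mem_iUnion.1 hT
    obtain ⟨V, hV, hTV⟩ := exists_ancestor hsub (Nat.zero_le k) T hk
    obtain rfl : V = q := hV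
    exact hQ.1.trans hTV
  · by_contra hcon
    have hcover (k : ℕ) : ∃ T ∈ stoppingGeneration F q k, c Q ⊆ c T := by
      induction k with
      | zero => exact ⟨q, rfl, hQ⟩
      | succ k ih =>
        obtain ⟨T, hT, hQT⟩ := ih
        by_contra hno
        exact hcon (mem_iUnion₂.2 ⟨T, mem_iUnion.2 ⟨k, hT⟩, hQT, fun U hU hQU =>
          hno ⟨U, mem_stoppingGeneration_succ.2 ⟨T, hT, hU⟩, hQU⟩⟩)
    set a : ℕ → ℝ≥0∞ := fun k => μ (⋃ T ∈ stoppingGeneration F q k, c T) with ha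
    have hdecay (k : ℕ) : a (k + 1) ≤ a k / 4 :=
      measure_stopping_le hm hvol (pairwiseDisjoint_stoppingGeneration hsub hdisj k) Subset.rfl
    have hle (k : ℕ) : μ (c Q) ≤ a k := by
      obtain ⟨T, hT, hQT⟩ := hcover k
      exact measure_mono (hQT.trans (subset_biUnion_of_mem (u := c) hT))
    have hsum : ∑' k, a k ≠ ∞ := by
      refine ne_top_of_le_ne_top (ENNReal.mul_ne_top (a := 4 / 3) ?_ (htop q))
        ((tsum_le_of_succ_le hdecay).trans (by simp [ha, stoppingGeneration]))
      exact ENNReal.div_ne_top (by simp) (by simp)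
    exact h0 Q (le_zero_iff.1
      (ge_of_tendsto' (ENNReal.tendsto_atTop_zero_of_tsum_ne_top hsum) hle))

lemma tsum_stopping_le [Countable α] (hm : ∀ T, MeasurableSet (c T)) (hne : ∀ T, (c T).Nonempty)
    (hnest : ∀ T T', (c T ∩ c T').Nonempty → c T ⊆ c T' ∨ c T' ⊆ c T)
    (hsub : ∀ T, ∀ U ∈ F T, c U ⊆ c T) (hdisj : ∀ T, (F T).PairwiseDisjoint c)
    (hvol : ∀ T, μ (⋃ U ∈ F T, c U) ≤ μ (c T) / 4) (P : α) :
    ∑' T : {T | T ∈ (⋃ k, stoppingGeneration F q k) ∧ c T ⊆ c P}, μ (c T) ≤ 4 / 3 * μ (c P) := by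
  classical
  set A : ℕ → Set α := fun k => {T | T ∈ stoppingGeneration F q k ∧ c T ⊆ c P} with hA
  by_cases hex : ∃ k, (A k).Nonempty
  swap
  · have : IsEmpty {T | T ∈ (⋃ k, stoppingGeneration F q k) ∧ c T ⊆ c P} := by
      refine ⟨fun T => ?_⟩
      obtain ⟨k, hk⟩ := mem_iUnion.1 T.2.1
      exact hex ⟨k, T, hk, T.2.2⟩
    simp
  set N := Nat.find hex
  obtain ⟨W, hW, hWP⟩ := Nat.find_spec hex
  have hdisjA (k : ℕ) : (A k).PairwiseDisjoint c :=
    (pairwiseDisjoint_stoppingGeneration hsub hdisj k).subset fun T hT => hT.1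
  have hsucc (k : ℕ) : A (N + (k + 1)) ⊆ ⋃ T ∈ A (N + k), F T := by
    rintro U ⟨hU, hUP⟩
    obtain ⟨V, hV, hUV⟩ := mem_stoppingGeneration_succ.1 hU
    refine mem_iUnion₂.2 ⟨V, ⟨hV, ?_⟩, hUV⟩
    rcases hnest V P ((hne U).mono (subset_inter (hsub V U hUV) hUP)) with h | h
    · exact h
    obtain ⟨V', hV', hVV'⟩ := exists_ancestor hsub (Nat.le_add_right N k) V hV
    obtain rfl : W = V' :=
      eq_of_inter_nonempty (pairwiseDisjoint_stoppingGeneration hsub hdisj N) hW hV'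
        ((hne W).mono (subset_inter Subset.rfl (hWP.trans (h.trans hVV'))))
    exact hVV'.trans hWP
  have hcover : {T | T ∈ (⋃ k, stoppingGeneration F q k) ∧ c T ⊆ c P} ⊆ ⋃ k, A (N + k) := by
    rintro T ⟨hT, hTP⟩
    obtain ⟨k, hk⟩ := mem_iUnion.1 hT
    refine mem_iUnion.2 ⟨k - N, ?_⟩
    rw [Nat.add_sub_cancel' (Nat.find_min' hex ⟨T, hk, hTP⟩)]
    exact ⟨hk, hTP⟩
  calc _ ≤ ∑' T : ⋃ k, A (N + k), μ (c T) := ENNReal.tsum_mono_subtype (fun T => μ (c T)) hcover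
    _ ≤ ∑' k, ∑' T : A (N + k), μ (c T) := ENNReal.tsum_iUnion_le_tsum (fun T => μ (c T)) _
    _ = ∑' k, μ (⋃ T ∈ A (N + k), c T) := by simp only [tsum_measure_eq hm (hdisjA _)]
    _ ≤ 4 / 3 * μ (⋃ T ∈ A N, c T) :=
        tsum_le_of_succ_le (a := fun k => μ (⋃ T ∈ A (N + k), c T)) fun k =>
          measure_stopping_le hm hvol (hdisjA _) (hsucc k)
    _ ≤ 4 / 3 * μ (c P) := by
        gcongr
        exact iUnion₂_subset fun T hT => hT.2

end Corona

namespace PCube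

variable {m : ℕ}

lemma countable (m : ℕ) : Countable (PCube m) := by
  refine Function.Injective.countable (f := fun Q : PCube m => (Q.k, Q.v, Q.j)) ?_
  rintro ⟨k, v, j⟩ ⟨k', v', j'⟩ h
  simpa using h

lemma mem_Ico_scale_iff {b : ℝ} (hb : 0 < b) (k v : ℤ) (x : ℝ) :
    x ∈ Ico (b ^ (-k) * v) (b ^ (-k) * (v + 1)) ↔ ⌊b ^ k * x⌋ = v := by
  have hbk : 0 < b ^ k := zpow_pos hb k
  rw [Int.floor_eq_iff, mem_Ico, zpow_neg, inv_mul_le_iff₀ hbk, lt_inv_mul_iff₀ hbk]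

lemma mem_carrier_iff {Q : PCube m} {p : EuclideanSpace ℝ (Fin m) × ℝ} :
    p ∈ Q.carrier ↔ (∀ i, ⌊(2 : ℝ) ^ Q.k * p.1 i⌋ = Q.v i) ∧ ⌊(4 : ℝ) ^ Q.k * p.2⌋ = Q.j := by
  simp only [carrier, mem_ofPred_eq, mem_Ico_scale_iff (two_pos : (0 : ℝ) < 2),
    mem_Ico_scale_iff (four_pos : (0 : ℝ) < 4)]

lemma floor_scale_eq {b : ℕ} (hb : b ≠ 0) {k l : ℤ} (hkl : k ≤ l) {x y : ℝ}
    (h : ⌊(b : ℝ) ^ l * x⌋ = ⌊(b : ℝ) ^ l * y⌋) : ⌊(b : ℝ) ^ k * x⌋ = ⌊(b : ℝ) ^ k * y⌋ := by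
  obtain ⟨d, rfl⟩ := Int.le.dest hkl
  have hb' : (b : ℝ) ≠ 0 := Nat.cast_ne_zero.2 hb
  have key (z : ℝ) : (b : ℝ) ^ k * z = (b : ℝ) ^ (k + d) * z / ((b ^ d : ℕ) : ℝ) := by
    rw [zpow_add₀ hb', zpow_natCast]
    push_cast
    field_simp
  rw [key x, key y, Int.floor_div_natCast, Int.floor_div_natCast, h]

lemma carrier_subset_of_le {Q Q' : PCube m} (hk : Q.k ≤ Q'.k)
    (h : (Q.carrier ∩ Q'.carrier).Nonempty) : Q'.carrier ⊆ Q.carrier := by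
  obtain ⟨p, hp, hp'⟩ := h
  intro x hx
  rw [mem_carrier_iff] at hp hp' hx ⊢
  refine ⟨fun i => ?_, ?_⟩
  · rw [← hp.1 i]
    exact_mod_cast floor_scale_eq two_ne_zero hk (by exact_mod_cast (hx.1 i).trans (hp'.1 i).symm)
  · rw [← hp.2]
    exact_mod_cast floor_scale_eq four_ne_zero hk (by exact_mod_cast hx.2.trans hp'.2.symm)

lemma carrier_nested (Q Q' : PCube m) (h : (Q.carrier ∩ Q'.carrier).Nonempty) :
    Q.carrier ⊆ Q'.carrier ∨ Q'.carrier ⊆ Q.carrier := by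
  rcases le_total Q.k Q'.k with hk | hk
  · exact Or.inr (carrier_subset_of_le hk h)
  · exact Or.inl (carrier_subset_of_le hk (by rwa [inter_comm]))

lemma carrier_eq_prod (Q : PCube m) : Q.carrier =
    ((@WithLp.ofLp 2 (Fin m → ℝ)) ⁻¹' univ.pi fun i =>
      Ico ((2 : ℝ) ^ (-Q.k) * Q.v i) ((2 : ℝ) ^ (-Q.k) * (Q.v i + 1))) ×ˢ
      Ico ((4 : ℝ) ^ (-Q.k) * Q.j) ((4 : ℝ) ^ (-Q.k) * (Q.j + 1)) := by
  ext p
  simp [carrier]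

lemma measurableSet_carrier (Q : PCube m) : MeasurableSet Q.carrier := by
  rw [carrier_eq_prod]
  exact ((PiLp.volume_preserving_ofLp (Fin m)).measurable
    (MeasurableSet.univ_pi fun i => measurableSet_Ico)).prod measurableSet_Ico

lemma volume_carrier (Q : PCube m) : volume Q.carrier =
    (∏ _i : Fin m, ENNReal.ofReal ((2 : ℝ) ^ (-Q.k))) * ENNReal.ofReal ((4 : ℝ) ^ (-Q.k)) := by
  rw [carrier_eq_prod, Measure.volume_eq_prod, Measure.prod_prod,
    (PiLp.volume_preserving_ofLp (Fin m)).measure_preimage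
      (MeasurableSet.univ_pi fun i => measurableSet_Ico).nullMeasurableSet, Real.volume_pi_Ico,
    Real.volume_Ico]
  ring_nf

lemma volume_carrier_ne_zero (Q : PCube m) : volume Q.carrier ≠ 0 := by
  rw [volume_carrier]
  refine mul_ne_zero (Finset.prod_ne_zero_iff.2 fun i _ => ?_) ?_ <;>
    exact (ENNReal.ofReal_pos.2 (by positivity)).ne'

lemma volume_carrier_ne_top (Q : PCube m) : volume Q.carrier ≠ ∞ := by
  rw [volume_carrier]
  exact ENNReal.mul_ne_top (ENNReal.prod_ne_top fun i _ => ENNReal.ofReal_ne_top)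
    ENNReal.ofReal_ne_top

lemma carrier_nonempty (Q : PCube m) : Q.carrier.Nonempty :=
  nonempty_of_measure_ne_zero Q.volume_carrier_ne_zero

end PCube

lemma semiCoherent_stoppingRegion {m : ℕ} {F : PCube m → Set (PCube m)} {T : PCube m}
    (hT : T ∈ stoppingRegion PCube.carrier F T) :
    SemiCoherent (stoppingRegion PCube.carrier F T) T :=
  ⟨hT, fun _ hQ => hQ.1, fun _ hQ' _ hQs _ h h' =>
    ⟨h'.trans hQs.1, fun U hU hQU => hQ'.2 U hU (h.trans hQU)⟩⟩

/-- Big pieces implies corona: if, below every cube `Q₀`, the relation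
`R(Q₀, ·)` holds outside a family of disjoint subcubes covering at most a quarter of `Q₀`,
then every `𝔻(Q*)` partitions into countably many semi-coherent stopping time regimes
`𝐒ᵢ` with `R(Q(𝐒ᵢ), Q)` for `Q ∈ 𝐒ᵢ`, whose maximal cubes satisfy a Carleson packing
condition with constant `4/3`. -/
theorem statement8
    (n : ℕ) (hn : 2 ≤ n)
    (R : PCube (n - 1) → PCube (n - 1) → Prop)
    (hyp : ∀ Q₀ : PCube (n - 1), ∃ F : Set (PCube (n - 1)),
      F.Countable ∧
      (∀ Q' ∈ F, Q'.carrier ⊆ Q₀.carrier) ∧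
      (F.Pairwise fun Q₁ Q₂ => Disjoint Q₁.carrier Q₂.carrier) ∧
      volume (⋃ Q' ∈ F, Q'.carrier) ≤ volume Q₀.carrier / 4 ∧
      ∀ Q : PCube (n - 1), Q.carrier ⊆ Q₀.carrier →
        (∀ Q' ∈ F, ¬ Q.carrier ⊆ Q'.carrier) → R Q₀ Q) :
    ∀ Qstar : PCube (n - 1),
      ∃ (I : Set (Set (PCube (n - 1)))) (top : Set (PCube (n - 1)) → PCube (n - 1)),
        I.Countable ∧
        (I.Pairwise fun S₁ S₂ => Disjoint S₁ S₂) ∧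
        (⋃ S ∈ I, S) = {Q : PCube (n - 1) | Q.carrier ⊆ Qstar.carrier} ∧
        (∀ S ∈ I, SemiCoherent S (top S)) ∧
        (∀ S ∈ I, ∀ Q ∈ S, R (top S) Q) ∧
        ∀ P : PCube (n - 1),
          (∑' S : {S : Set (PCube (n - 1)) // S ∈ I ∧ (top S).carrier ⊆ P.carrier},
            volume (top S.1).carrier) ≤ (4 / 3 : ENNReal) * volume P.carrier := by
  intro Qstar
  choose F _ hsub hdisj hvol hR using hyp
  have : Countable (PCube (n - 1)) := PCube.countable _
  have hself := mem_stoppingRegion_self PCube.volume_carrier_ne_zero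
    PCube.volume_carrier_ne_top hvol
  set tops : Set (PCube (n - 1)) := ⋃ k, stoppingGeneration F Qstar k
  set region : PCube (n - 1) → Set (PCube (n - 1)) := stoppingRegion PCube.carrier F
  have hreg : tops.PairwiseDisjoint region :=
    pairwiseDisjoint_stoppingRegion PCube.carrier_nonempty hsub hdisj
  have hinj : InjOn region tops := fun T hT T' hT' h =>
    hreg.elim_set hT hT' T (hself T) (h ▸ hself T)
  have : Nonempty (PCube (n - 1)) := ⟨Qstar⟩
  have htop : ∀ T ∈ tops, invFunOn region tops (region T) = T := hinj.leftInvOn_invFunOn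
  refine ⟨region '' tops, invFunOn region tops, tops.to_countable.image _,
    ?_, ?_, ?_, ?_, fun P => ?_⟩
  · rintro _ ⟨T, hT, rfl⟩ _ ⟨T', hT', rfl⟩ hne
    exact hreg hT hT' fun h => hne (congrArg region h)
  · rw [biUnion_image]
    exact biUnion_stoppingRegion PCube.measurableSet_carrier PCube.volume_carrier_ne_zero
      PCube.volume_carrier_ne_top hsub hdisj hvol
  · rintro _ ⟨T, hT, rfl⟩
    rw [htop T hT]
    exact semiCoherent_stoppingRegion (hself T)
  · rintro _ ⟨T, hT, rfl⟩ Q hQ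
    rw [htop T hT]
    exact hR T Q hQ.1 hQ.2
  · refine le_trans ?_ (tsum_stopping_le (q := Qstar) PCube.measurableSet_carrier
      PCube.carrier_nonempty PCube.carrier_nested hsub hdisj hvol P)
    let e : {S // S ∈ region '' tops ∧ (invFunOn region tops S).carrier ⊆ P.carrier} →
        {T | T ∈ tops ∧ T.carrier ⊆ P.carrier} :=
      fun S => ⟨invFunOn region tops S.1, invFunOn_mem S.2.1, S.2.2⟩
    have he : Injective e := fun S S' h => Subtype.ext <| by
      rw [← invFunOn_eq S.2.1, ← invFunOn_eq S'.2.1]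
      exact congrArg region (congrArg Subtype.val h)
    exact ENNReal.tsum_comp_le_tsum_of_injective he fun T => volume T.1.carrier
end
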